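/- arXiv:1909.05844 — 5 statements merged into one kernel-verified Lean document; each statement's English description precedes it below -/
import Mathlib

section
/- Corollary 1. Under the assumptions of Theorem 1 (quadratic losses with σ I_d ⪯ H_j ⪯ L I_d), if the regularization parameter is set so that μ + σ = (180 L/(1 − α)²)·(β/σ + 1), then the convergence rate ρ₁ := max{ (1 + θ₁)/2, α + (140 κ/(1 − α))·((σ + β)/(σ + μ)), (1 + α)/2 + 2β/(σ + μ) } satisfies ρ₁ ≤ 1 − ((1 − α)/20)² · (1/κ) · 1/(β/σ + 1). -/
open Finset Matrix

noncomputable section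

/-- Spectral (ℓ₂ operator) norm of a square real matrix. -/
def specNorm {m : Type*} [Fintype m] [DecidableEq m] (A : Matrix m m ℝ) : ℝ :=
  ‖Matrix.toEuclideanCLM (𝕜 := ℝ) A‖

/-- The spectral norm is nonnegative. -/
theorem specNorm_nonneg {m : Type*} [Fintype m] [DecidableEq m] (A : Matrix m m ℝ) :
    0 ≤ specNorm A :=
  norm_nonneg _

/-- The heterogeneity term of `θ₁` is at most a tenth of `σ / M`, where `M = σ + μ`, as soon as
`M` dominates `180 (β + σ)` and `180 L (β + σ) / σ`. -/
theorem heterogeneity_term_le {σ L β M D : ℝ} (hσ : 0 < σ) (hL : 0 < L) (hβ : 0 ≤ β)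
    (hM : 180 * (β + σ) ≤ M) (hML : 180 * L * (β + σ) ≤ M * σ) (hD : M ≤ D) :
    L / D * (β ^ 2 / (M * (M - β))) ≤ σ / M / 10 := by
  have hM0 : 0 < M := by linarith
  have hLD : L / D ≤ σ / (β + σ) := by
    rw [div_le_div_iff₀ (by linarith) (by linarith)]
    nlinarith [mul_le_mul_of_nonneg_right hD hσ.le, mul_pos hL (add_pos_of_nonneg_of_pos hβ hσ)]
  have hquot : β ^ 2 / (M * (M - β)) ≤ (β + σ) / M / 10 := by
    rw [div_div, div_le_div_iff₀ (mul_pos hM0 (by linarith)) (by linarith)]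
    have : 10 * β ^ 2 ≤ (β + σ) * (M - β) := by nlinarith
    nlinarith [mul_le_mul_of_nonneg_left this hM0.le]
  calc L / D * (β ^ 2 / (M * (M - β)))
      ≤ σ / (β + σ) * ((β + σ) / M / 10) :=
        mul_le_mul hLD hquot
          (div_nonneg (sq_nonneg _) (mul_nonneg hM0.le (by linarith))) (by positivity)
    _ = σ / M / 10 := by
        have : β + σ ≠ 0 := by linarith
        field_simp

/-- **Corollary 1.** Under the quadratic-loss assumptions of Theorem 1
(`σ I ⪯ H_j ⪯ L I`, `β = max_j ‖H_j − H̄‖`, mixing rate `α = α₀^K ∈ [0,1)`), if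
`μ + σ = 180 L/(1-α)² (β/σ + 1)`, then
`ρ₁ := max {(1+θ₁)/2, α + 140κ/(1-α)·(σ+β)/(σ+μ), (1+α)/2 + 2β/(σ+μ)}` satisfies
`ρ₁ ≤ 1 − ((1-α)/20)² · (1/κ) · 1/(β/σ + 1)`. -/
theorem network_dane_quadratic_rate_corollary
    (n d K : ℕ) (hn : 0 < n) (hd : 0 < d) (hK : 1 ≤ K)
    (σ L μ β α₀ α κ θ₁ ρ₁ : ℝ)
    (hσ : 0 < σ) (hσL : σ ≤ L) (hκ : κ = L / σ)
    (H : Fin n → Matrix (Fin d) (Fin d) ℝ)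
    (hHsymm : ∀ j, (H j).IsSymm)
    (hHlow : ∀ j, (H j - σ • (1 : Matrix (Fin d) (Fin d) ℝ)).PosSemidef)
    (hHup : ∀ j, (L • (1 : Matrix (Fin d) (Fin d) ℝ) - H j).PosSemidef)
    (Hbar : Matrix (Fin d) (Fin d) ℝ) (hHbar : Hbar = (n : ℝ)⁻¹ • ∑ j, H j)
    (hβ : IsGreatest (Set.range fun j => specNorm (H j - Hbar)) β)
    (W : Matrix (Fin n) (Fin n) ℝ)
    (hW1 : W.mulVec (fun _ => 1) = fun _ => 1)
    (hW2 : Wᵀ.mulVec (fun _ => 1) = fun _ => 1)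
    (hα₀ : α₀ = specNorm (W - Matrix.of fun _ _ => (n : ℝ)⁻¹))
    (hα₀lt : α₀ < 1) (hα : α = α₀ ^ K)
    -- choice of the regularization parameter
    (hμ : μ + σ = 180 * L / (1 - α) ^ 2 * (β / σ + 1))
    (hθ : θ₁ = 1 - σ / (σ + μ) + L / (L + μ) * (β ^ 2 / ((σ + μ) * (σ + μ - β))))
    (hρ : ρ₁ = max (max ((1 + θ₁) / 2)
        (α + 140 * κ / (1 - α) * ((σ + β) / (σ + μ))))
        ((1 + α) / 2 + 2 * β / (σ + μ))) :
    ρ₁ ≤ 1 - ((1 - α) / 20) ^ 2 * (1 / κ) * (1 / (β / σ + 1)) := by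
  have hβ0 : 0 ≤ β := by
    obtain ⟨j, rfl⟩ := hβ.1
    exact specNorm_nonneg _
  have hα₀0 : 0 ≤ α₀ := hα₀ ▸ specNorm_nonneg _
  have hα0 : 0 ≤ α := hα ▸ pow_nonneg hα₀0 K
  have hα1 : α < 1 := hα ▸ pow_lt_one₀ hα₀0 hα₀lt (by omega)
  have hL : 0 < L := hσ.trans_le hσL
  obtain ⟨a, ha⟩ : ∃ a, a = 1 - α := ⟨_, rfl⟩
  have ha0 : 0 < a := by linarith
  have ha1 : a ≤ 1 := by linarith
  have ha2 : a ^ 2 ≤ a := by nlinarith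
  obtain ⟨M, hM⟩ : ∃ M, M = σ + μ := ⟨_, rfl⟩
  have hb : 0 < β + σ := by linarith
  rw [← hM] at hθ hρ
  rw [← ha] at hμ hρ ⊢
  have hMeq : M = 180 * L * (β + σ) / (a ^ 2 * σ) := by
    rw [hM, add_comm, hμ]
    field_simp
  have hMa : M * σ * a ^ 2 = 180 * L * (β + σ) := by
    rw [hMeq]
    field_simp
  have hM0 : 0 < M := by
    rw [hMeq]
    positivity
  have hML : 180 * L * (β + σ) ≤ M * σ := by
    nlinarith [mul_pos hM0 hσ]
  have hMa' : 180 * (β + σ) ≤ M * a ^ 2 := by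
    have : 180 * (β + σ) * σ ≤ M * a ^ 2 * σ := by
      nlinarith [mul_le_mul_of_nonneg_right hσL hb.le]
    exact le_of_mul_le_mul_right this hσ
  have hMb : 180 * (β + σ) ≤ M := by nlinarith
  have hrate : (a / 20) ^ 2 * (1 / κ) * (1 / (β / σ + 1)) = 9 / 20 * (σ / M) := by
    rw [hκ, hMeq]
    field_simp
    norm_num
  have hσM : σ / M ≤ a ^ 2 / 180 := by
    rw [div_le_div_iff₀ hM0 (by norm_num)]
    linarith
  have hβM : 2 * β / M ≤ a ^ 2 / 90 := by
    rw [div_le_div_iff₀ hM0 (by norm_num)]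
    linarith
  have hhet := heterogeneity_term_le hσ hL hβ0 hMb hML (D := L + μ) (by linarith)
  have hmix : 140 * κ / a * ((σ + β) / M) = 7 / 9 * a := by
    rw [hκ, hMeq, add_comm σ β]
    field_simp
    norm_num
  rw [hrate, hρ]
  refine max_le (max_le ?_ ?_) ?_
  · rw [hθ]
    linarith
  · rw [hmix]
    linarith
  · linarith

end
end

section
/- Gradient-tracking error recursion. Suppose each local loss f_j : ℝ^d → ℝ is differentiable and L-smooth (‖∇f_j(x) − ∇f_j(y)‖ ≤ L‖x − y‖), and the homogeneity condition ‖∇(f − f_j)(x) − ∇(f − f_j)(y)‖ ≤ β‖x − y‖ holds for all j, x, y, where f = (1/n)∑_j f_j has minimizer y*. If s^(t) = (W^K ⊗ I_d) s^(t−1) + ∇F(y^(t)) − ∇F(y^(t−1)) with (1/n)(1_nᵀ ⊗ I_d) s^(t−1) = (1/n)(1_nᵀ ⊗ I_d) ∇F(y^(t−1)), then ‖s^(t) − ∇f(y^(t))‖ ≤ α‖s^(t−1) − ∇f(y^(t−1))‖ + β‖y^(t) − 1_n ⊗ ȳ^(t)‖ + β√n‖ȳ^(t) − y*‖ + (αβ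 + (α + 1)L)‖y^(t−1) − 1_n ⊗ ȳ^(t−1)‖ + β√n‖ȳ^(t−1) − y*‖. -/
open Finset Matrix
open scoped RealInnerProductSpace

noncomputable section

/-- Euclidean norm of a stacked vector in `(ℝ^d)^n ≅ ℝ^{nd}`. -/
def stackNormE {n d : ℕ} (v : Fin n → EuclideanSpace ℝ (Fin d)) : ℝ :=
  Real.sqrt (∑ j, ‖v j‖ ^ 2)

theorem stackNormE_eq_norm {n d : ℕ} (v : Fin n → EuclideanSpace ℝ (Fin d)) :
    stackNormE v = ‖(WithLp.toLp 2 v : PiLp 2 fun _ : Fin n => EuclideanSpace ℝ (Fin d))‖ := by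
  rw [PiLp.norm_eq_of_L2]
  rfl

theorem stackNormE_nonneg {n d : ℕ} (v : Fin n → EuclideanSpace ℝ (Fin d)) :
    0 ≤ stackNormE v :=
  Real.sqrt_nonneg _

theorem stackNormE_sq {n d : ℕ} (v : Fin n → EuclideanSpace ℝ (Fin d)) :
    stackNormE v ^ 2 = ∑ j, ‖v j‖ ^ 2 :=
  Real.sq_sqrt (Finset.sum_nonneg fun _ _ => sq_nonneg _)

theorem stackNormE_add_le {n d : ℕ} (u v : Fin n → EuclideanSpace ℝ (Fin d)) :
    stackNormE (fun j => u j + v j) ≤ stackNormE u + stackNormE v := by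
  simp only [stackNormE_eq_norm]
  exact norm_add_le (WithLp.toLp 2 u : PiLp 2 fun _ : Fin n => EuclideanSpace ℝ (Fin d))
    (WithLp.toLp 2 v)

theorem stackNormE_const {n d : ℕ} (c : EuclideanSpace ℝ (Fin d)) :
    stackNormE (fun _ : Fin n => c) = Real.sqrt n * ‖c‖ := by
  simp [stackNormE]

/-- No sign condition on `c` is needed: for `c < 0` the hypothesis forces `u = v = 0`. -/
theorem stackNormE_le_mul_of_norm_le {n d : ℕ} {u v : Fin n → EuclideanSpace ℝ (Fin d)} {c : ℝ}
    (h : ∀ j, ‖u j‖ ≤ c * ‖v j‖) : stackNormE u ≤ c * stackNormE v := by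
  rcases le_or_gt 0 c with hc | hc
  · refine Real.sqrt_le_iff.2 ⟨mul_nonneg hc (stackNormE_nonneg v), ?_⟩
    rw [mul_pow, stackNormE_sq, Finset.mul_sum]
    refine Finset.sum_le_sum fun j _ => ?_
    rw [← mul_pow]
    exact pow_le_pow_left₀ (norm_nonneg _) (h j) 2
  · have hv : ∀ j, ‖v j‖ = 0 := fun j => by
      nlinarith [h j, norm_nonneg (u j), norm_nonneg (v j)]
    have hu : ∀ j, ‖u j‖ = 0 := fun j =>
      le_antisymm (by simpa [hv j] using h j) (norm_nonneg _)
    simp [stackNormE, hu, hv]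

/-- The action of `A ⊗ I` on stacked vectors is bounded by the spectral norm of `A`. -/
theorem stackNormE_sum_smul_le {n d : ℕ} (A : Matrix (Fin n) (Fin n) ℝ)
    (v : Fin n → EuclideanSpace ℝ (Fin d)) :
    stackNormE (fun j => ∑ i, A j i • v i) ≤ specNorm A * stackNormE v := by
  have hA : 0 ≤ specNorm A := norm_nonneg _
  refine Real.sqrt_le_iff.2 ⟨mul_nonneg hA (stackNormE_nonneg v), ?_⟩
  have hcoord : ∀ k, ∑ j, ((∑ i, A j i • v i) k) ^ 2 ≤ specNorm A ^ 2 * ∑ j, (v j k) ^ 2 := by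
    intro k
    have h := (Matrix.toEuclideanCLM (𝕜 := ℝ) A).le_opNorm (WithLp.toLp 2 fun j => v j k)
    have h2 := pow_le_pow_left₀ (norm_nonneg _) h 2
    rw [mul_pow, EuclideanSpace.real_norm_sq_eq, EuclideanSpace.real_norm_sq_eq] at h2
    simpa [specNorm, Matrix.mulVec, dotProduct] using h2
  rw [mul_pow, stackNormE_sq]
  simp only [EuclideanSpace.real_norm_sq_eq]
  rw [Finset.sum_comm, Finset.sum_comm (f := fun j k => (v j k) ^ 2), Finset.mul_sum]
  exact Finset.sum_le_sum fun k _ => hcoord k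

theorem stackNormE_sub_mean_le {n d : ℕ} (hn : 0 < n) (v : Fin n → EuclideanSpace ℝ (Fin d)) :
    stackNormE (fun j => v j - (n : ℝ)⁻¹ • ∑ i, v i) ≤ stackNormE v := by
  have hn' : (n : ℝ) ≠ 0 := by positivity
  refine Real.sqrt_le_sqrt ?_
  set m := (n : ℝ)⁻¹ • ∑ i, v i with hm
  have hsum : ∑ i, v i = (n : ℝ) • m := by rw [hm, smul_inv_smul₀ hn']
  have hinner : ∑ j, inner ℝ (v j) m = n * ‖m‖ ^ 2 := by
    rw [← sum_inner, hsum, real_inner_smul_left, real_inner_self_eq_norm_sq]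
  simp only [norm_sub_sq_real, Finset.sum_add_distrib, Finset.sum_sub_distrib, ← Finset.mul_sum,
    hinner, Finset.sum_const, Finset.card_univ, Fintype.card_fin, nsmul_eq_mul]
  nlinarith [mul_nonneg n.cast_nonneg (sq_nonneg ‖m‖)]

theorem gradient_mean {n d : ℕ} {f : Fin n → EuclideanSpace ℝ (Fin d) → ℝ}
    (hdiff : ∀ j, Differentiable ℝ (f j)) {g : EuclideanSpace ℝ (Fin d) → ℝ}
    (hg : ∀ z, g z = (n : ℝ)⁻¹ * ∑ j, f j z) (z : EuclideanSpace ℝ (Fin d)) :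
    gradient g z = (n : ℝ)⁻¹ • ∑ j, gradient (f j) z := by
  have h : HasFDerivAt g ((n : ℝ)⁻¹ • ∑ j, fderiv ℝ (f j) z) z := by
    rw [funext hg]
    exact (HasFDerivAt.fun_sum fun j _ => (hdiff j z).hasFDerivAt).const_mul _
  simp [gradient, h.fderiv]

theorem gradient_eq_zero_of_forall_le {d : ℕ} {g : EuclideanSpace ℝ (Fin d) → ℝ}
    {x : EuclideanSpace ℝ (Fin d)} (h : ∀ z, g x ≤ g z) : gradient g x = 0 := by
  have hx : IsLocalMin g x := Filter.Eventually.of_forall h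
  simp [gradient, hx.fderiv_eq_zero]

theorem pow_mulVec_eq_self {n : ℕ} {W : Matrix (Fin n) (Fin n) ℝ} {v : Fin n → ℝ}
    (h : W.mulVec v = v) (K : ℕ) : (W ^ K).mulVec v = v := by
  induction K with
  | zero => simp
  | succ k ih => rw [pow_succ, ← Matrix.mulVec_mulVec, h, ih]

theorem norm_mean_sub_mean_le {n d : ℕ} (hn : 0 < n) {u v : Fin n → EuclideanSpace ℝ (Fin d)}
    {c : ℝ} (h : ∀ j, ‖u j - v j‖ ≤ c) :
    ‖(n : ℝ)⁻¹ • ∑ j, u j - (n : ℝ)⁻¹ • ∑ j, v j‖ ≤ c := by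
  have hn' : (0 : ℝ) < n := by positivity
  rw [← smul_sub, ← Finset.sum_sub_distrib, norm_smul, Real.norm_of_nonneg (by positivity),
    inv_mul_le_iff₀ hn']
  simpa using norm_sum_le_of_le Finset.univ fun j _ => h j

/-- **Gradient-tracking error recursion.**  For `L`-smooth local losses `f_j` satisfying
the homogeneity condition `‖∇(f−f_j)(x) − ∇(f−f_j)(y)‖ ≤ β‖x−y‖`, the gradient-tracking
update `s⁽ᵗ⁾ = (W^K ⊗ I) s⁽ᵗ⁻¹⁾ + ∇F(y⁽ᵗ⁾) − ∇F(y⁽ᵗ⁻¹⁾)`, started so that the mean of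
`s⁽ᵗ⁻¹⁾` equals the mean of `∇F(y⁽ᵗ⁻¹⁾)`, satisfies
`‖s⁽ᵗ⁾ − ∇f(y⁽ᵗ⁾)‖ ≤ α‖s⁽ᵗ⁻¹⁾ − ∇f(y⁽ᵗ⁻¹⁾)‖ + β‖y⁽ᵗ⁾ − 1ₙ⊗ȳ⁽ᵗ⁾‖ + β√n‖ȳ⁽ᵗ⁾ − y*‖
  + (αβ + (α+1)L)‖y⁽ᵗ⁻¹⁾ − 1ₙ⊗ȳ⁽ᵗ⁻¹⁾‖ + β√n‖ȳ⁽ᵗ⁻¹⁾ − y*‖`. -/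
theorem gradient_tracking_error_recursion
    {n d : ℕ} (hn : 0 < n) (K : ℕ) (hK : 1 ≤ K)
    (L β α : ℝ)
    (f : Fin n → EuclideanSpace ℝ (Fin d) → ℝ)
    (hdiff : ∀ j, Differentiable ℝ (f j))
    (hsmooth : ∀ j a b', ‖gradient (f j) a - gradient (f j) b'‖ ≤ L * ‖a - b'‖)
    (fglob : EuclideanSpace ℝ (Fin d) → ℝ)
    (hfglob : ∀ z, fglob z = (n : ℝ)⁻¹ * ∑ j, f j z)
    (hhom : ∀ j a b',
      ‖(gradient fglob a - gradient (f j) a) - (gradient fglob b' - gradient (f j) b')‖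
        ≤ β * ‖a - b'‖)
    (ystar : EuclideanSpace ℝ (Fin d)) (hstar : ∀ z, fglob ystar ≤ fglob z)
    (W : Matrix (Fin n) (Fin n) ℝ)
    (hW1 : W.mulVec (fun _ => 1) = fun _ => 1)
    (hW2 : Wᵀ.mulVec (fun _ => 1) = fun _ => 1)
    (hα : α = specNorm (W ^ K - Matrix.of fun _ _ => (n : ℝ)⁻¹))
    (sPrev sCur yPrev yCur : Fin n → EuclideanSpace ℝ (Fin d))
    (hs : ∀ j, sCur j = (∑ i, (W ^ K) j i • sPrev i)
      + (gradient (f j) (yCur j) - gradient (f j) (yPrev j)))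
    (hmean : (n : ℝ)⁻¹ • ∑ j, sPrev j = (n : ℝ)⁻¹ • ∑ j, gradient (f j) (yPrev j)) :
    stackNormE (fun j => sCur j - gradient fglob (yCur j))
      ≤ α * stackNormE (fun j => sPrev j - gradient fglob (yPrev j))
        + β * stackNormE (fun j => yCur j - (n : ℝ)⁻¹ • ∑ i, yCur i)
        + β * Real.sqrt n * ‖(n : ℝ)⁻¹ • ∑ i, yCur i - ystar‖
        + (α * β + (α + 1) * L) * stackNormE (fun j => yPrev j - (n : ℝ)⁻¹ • ∑ i, yPrev i)
        + β * Real.sqrt n * ‖(n : ℝ)⁻¹ • ∑ i, yPrev i - ystar‖ := by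
  have hn' : (n : ℝ) ≠ 0 := by positivity
  have hgrad := gradient_mean hdiff hfglob
  have hgrad_star : gradient fglob ystar = 0 := gradient_eq_zero_of_forall_le hstar
  set yb := (n : ℝ)⁻¹ • ∑ i, yCur i
  set pb := (n : ℝ)⁻¹ • ∑ i, yPrev i
  set A : Matrix (Fin n) (Fin n) ℝ := W ^ K - Matrix.of fun _ _ => (n : ℝ)⁻¹ with hA
  have hα0 : 0 ≤ α := hα ▸ norm_nonneg _
  have hsmooth_glob : ∀ a b, ‖gradient fglob a - gradient fglob b‖ ≤ L * ‖a - b‖ := fun a b => by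
    rw [hgrad a, hgrad b]
    exact norm_mean_sub_mean_le hn fun j => hsmooth j a b
  have hrow : ∀ j, ∑ i, A j i = 0 := fun j => by
    have h := congrFun (pow_mulVec_eq_self hW1 K) j
    simp only [Matrix.mulVec, dotProduct, mul_one] at h
    simp [hA, Finset.sum_sub_distrib, h, hn']
  have hAs : ∀ j, ∑ i, A j i • sPrev i
      = ∑ i, (W ^ K) j i • sPrev i - (n : ℝ)⁻¹ • ∑ i, gradient (f i) (yPrev i) := fun j => by
    rw [← hmean, Finset.smul_sum, ← Finset.sum_sub_distrib]
    simp [hA, sub_smul]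
  let δ : Fin n → EuclideanSpace ℝ (Fin d) → EuclideanSpace ℝ (Fin d) :=
    fun j z => gradient fglob z - gradient (f j) z
  let q : Fin n → EuclideanSpace ℝ (Fin d) :=
    fun j => gradient (f j) pb - gradient (f j) (yPrev j)
  have hdecomp : (fun j => sCur j - gradient fglob (yCur j)) = fun j =>
      (((∑ i, A j i • (sPrev i - gradient fglob (yPrev i))) + (δ j ystar - δ j (yCur j)))
        + ∑ i, A j i • (gradient fglob (yPrev i) - gradient fglob pb))
        + (q j - (n : ℝ)⁻¹ • ∑ i, q i) + (δ j pb - δ j ystar) := by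
    funext j
    have hconst : ∑ i, A j i • gradient fglob pb = 0 := by
      rw [← Finset.sum_smul, hrow, zero_smul]
    simp only [smul_sub, Finset.sum_sub_distrib, hconst, hAs, hs, δ, q, hgrad_star]
    rw [hgrad pb]
    abel
  have htrack := stackNormE_sum_smul_le A fun i => sPrev i - gradient fglob (yPrev i)
  have hcur : stackNormE (fun j => δ j ystar - δ j (yCur j))
      ≤ β * stackNormE (fun j => (yCur j - yb) + (yb - ystar)) :=
    stackNormE_le_mul_of_norm_le fun j => by
      rw [sub_add_sub_cancel, norm_sub_rev (yCur j)]
      exact hhom j _ _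
  have hβ_add : β * stackNormE (fun j => (yCur j - yb) + (yb - ystar))
      ≤ β * stackNormE (fun j => yCur j - yb) + β * Real.sqrt n * ‖yb - ystar‖ := by
    rcases le_or_gt 0 β with hβ | hβ
    · have h := mul_le_mul_of_nonneg_left
        (stackNormE_add_le (fun j => yCur j - yb) fun _ => yb - ystar) hβ
      rw [stackNormE_const] at h
      linarith
    · have hzero : ∀ a b : EuclideanSpace ℝ (Fin d), ‖a - b‖ = 0 := fun a b => by
        nlinarith [(norm_nonneg _).trans (hhom ⟨0, hn⟩ a b), norm_nonneg (a - b)]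
      simp [stackNormE, hzero]
  have hmix := stackNormE_sum_smul_le A fun i => gradient fglob (yPrev i) - gradient fglob pb
  have hglob : stackNormE (fun i => gradient fglob (yPrev i) - gradient fglob pb)
      ≤ L * stackNormE (fun i => yPrev i - pb) :=
    stackNormE_le_mul_of_norm_le fun i => hsmooth_glob _ _
  have hq : stackNormE q ≤ L * stackNormE (fun i => yPrev i - pb) :=
    stackNormE_le_mul_of_norm_le fun i => by
      rw [norm_sub_rev (yPrev i)]
      exact hsmooth i _ _
  have hqmean := stackNormE_sub_mean_le hn q
  have hprev : stackNormE (fun j => δ j pb - δ j ystar)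
      ≤ β * stackNormE (fun _ : Fin n => pb - ystar) :=
    stackNormE_le_mul_of_norm_le fun j => hhom j _ _
  have hβ_nonneg : 0 ≤ β * stackNormE (fun i => yPrev i - pb) :=
    (stackNormE_nonneg fun j => δ j (yPrev j) - δ j pb).trans
      (stackNormE_le_mul_of_norm_le fun j => hhom j _ _)
  rw [stackNormE_const] at hprev
  rw [← hα] at htrack hmix
  have hglob' := mul_le_mul_of_nonneg_left hglob hα0
  have hαβ := mul_nonneg hα0 hβ_nonneg
  rw [hdecomp]
  refine (stackNormE_add_le _ _).trans ?_
  refine (add_le_add_left (stackNormE_add_le _ _) _).trans ?_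
  refine (add_le_add_left (add_le_add_left (stackNormE_add_le _ _) _) _).trans ?_
  refine (add_le_add_left (add_le_add_left (add_le_add_left (stackNormE_add_le _ _) _) _) _).trans
    ?_
  linarith

end
end

section
/- Consensus-error recursion for Network-DANE with quadratic losses. For every t ≥ 1, ‖y^(t) − 1_n ⊗ ȳ^(t)‖ ≤ (α + αL/(σ + μ))·‖y^(t−1) − 1_n ⊗ ȳ^(t−1)‖ + (α/(σ + μ))·‖s^(t−1) − ∇f(y^(t−1))‖ + (αL/(L + μ))·(β/(σ + μ))·√n‖ȳ^(t−1) − y*‖. -/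
open Finset Matrix

noncomputable section

/-- Euclidean norm of a vector in `ℝ^d`. -/
def vecNorm {d : ℕ} (v : Fin d → ℝ) : ℝ := Real.sqrt (∑ i, v i ^ 2)

/-- Euclidean norm of a stacked vector in `ℝ^{nd}`. -/
def stackNorm {n d : ℕ} (v : Fin n → Fin d → ℝ) : ℝ := Real.sqrt (∑ j, ∑ i, v j i ^ 2)

lemma vecNorm_eq_norm {d : ℕ} (v : Fin d → ℝ) : vecNorm v = ‖WithLp.toLp 2 v‖ := by
  simp [vecNorm, EuclideanSpace.norm_eq]

lemma vecNorm_nonneg {d : ℕ} (v : Fin d → ℝ) : 0 ≤ vecNorm v := Real.sqrt_nonneg _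

lemma vecNorm_sq {d : ℕ} (v : Fin d → ℝ) : vecNorm v ^ 2 = v ⬝ᵥ v := by
  rw [vecNorm, Real.sq_sqrt (Finset.sum_nonneg fun i _ => sq_nonneg _)]
  simp [dotProduct, sq]

lemma vecNorm_neg {d : ℕ} (v : Fin d → ℝ) : vecNorm (-v) = vecNorm v := by
  simp [vecNorm]

lemma dotProduct_le_vecNorm_mul {d : ℕ} (u v : Fin d → ℝ) :
    u ⬝ᵥ v ≤ vecNorm u * vecNorm v := by
  have h := real_inner_le_norm (WithLp.toLp 2 v) (WithLp.toLp 2 u)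
  rw [EuclideanSpace.inner_toLp_toLp] at h
  rw [vecNorm_eq_norm, vecNorm_eq_norm, mul_comm]
  simpa using h

lemma vecNorm_mulVec_le {d : ℕ} (A : Matrix (Fin d) (Fin d) ℝ) (v : Fin d → ℝ) :
    vecNorm (A *ᵥ v) ≤ specNorm A * vecNorm v := by
  have h := (Matrix.toEuclideanCLM (𝕜 := ℝ) A).le_opNorm (WithLp.toLp 2 v)
  rw [Matrix.toEuclideanCLM_toLp] at h
  rwa [vecNorm_eq_norm, vecNorm_eq_norm]

lemma stackNorm_nonneg {n d : ℕ} (v : Fin n → Fin d → ℝ) : 0 ≤ stackNorm v :=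
  Real.sqrt_nonneg _

lemma stackNorm_eq_norm {n d : ℕ} (v : Fin n → Fin d → ℝ) :
    stackNorm v = ‖WithLp.toLp 2 (fun j => WithLp.toLp 2 (v j))‖ := by
  rw [PiLp.norm_eq_of_L2, stackNorm]
  simp [EuclideanSpace.norm_sq_eq]

lemma stackNorm_sub_le {n d : ℕ} (v w : Fin n → Fin d → ℝ) :
    stackNorm (fun j => v j - w j) ≤ stackNorm v + stackNorm w := by
  rw [stackNorm_eq_norm, stackNorm_eq_norm, stackNorm_eq_norm]
  exact norm_sub_le (WithLp.toLp 2 (fun j => WithLp.toLp 2 (v j)))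
    (WithLp.toLp 2 (fun j => WithLp.toLp 2 (w j)))

lemma stackNorm_eq_sqrt {n d : ℕ} (v : Fin n → Fin d → ℝ) :
    stackNorm v = √(∑ j, vecNorm (v j) ^ 2) := by
  rw [stackNorm]
  congr 1
  exact Finset.sum_congr rfl fun j _ => by
    rw [vecNorm, Real.sq_sqrt (Finset.sum_nonneg fun i _ => sq_nonneg _)]

lemma stackNorm_const {n d : ℕ} (v : Fin d → ℝ) :
    stackNorm (fun _ : Fin n => v) = √n * vecNorm v := by
  rw [stackNorm_eq_sqrt]
  simp [Real.sqrt_sq (vecNorm_nonneg v)]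

lemma stackNorm_le_mul {n d : ℕ} {c : ℝ} (hc : 0 ≤ c) {v w : Fin n → Fin d → ℝ}
    (h : ∀ j, vecNorm (v j) ≤ c * vecNorm (w j)) : stackNorm v ≤ c * stackNorm w := by
  rw [stackNorm_eq_sqrt, stackNorm_eq_sqrt, ← Real.sqrt_sq hc, ← Real.sqrt_mul (sq_nonneg c),
    Finset.mul_sum]
  refine Real.sqrt_le_sqrt (Finset.sum_le_sum fun j _ => ?_)
  rw [← mul_pow]
  exact pow_le_pow_left₀ (vecNorm_nonneg _) (h j) 2

/-- A matrix acting across the blocks of a stacked vector contracts by its spectral norm. -/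
lemma stackNorm_sum_smul_le {n d : ℕ} (A : Matrix (Fin n) (Fin n) ℝ)
    (v : Fin n → Fin d → ℝ) :
    stackNorm (fun j => ∑ i, A j i • v i) ≤ specNorm A * stackNorm v := by
  have hA : 0 ≤ specNorm A := norm_nonneg _
  have comm (w : Fin n → Fin d → ℝ) : stackNorm w = stackNorm (fun k j => w j k) := by
    rw [stackNorm, Finset.sum_comm, stackNorm]
  rw [comm, comm v]
  refine stackNorm_le_mul hA fun k => ?_
  convert vecNorm_mulVec_le A (fun j => v j k) using 2
  ext j
  simp [mulVec, dotProduct]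

lemma specNorm_pow_le {m : Type*} [Fintype m] [DecidableEq m] (A : Matrix m m ℝ) {k : ℕ}
    (hk : 1 ≤ k) : specNorm (A ^ k) ≤ specNorm A ^ k := by
  rw [specNorm, map_pow]
  exact norm_pow_le' _ hk

/-- The averaging matrix `(1/n) 1 1ᵀ`. -/
abbrev avgMatrix (n : ℕ) : Matrix (Fin n) (Fin n) ℝ := Matrix.of fun _ _ => (n : ℝ)⁻¹

lemma avgMatrix_mul_self {n : ℕ} (hn : 0 < n) : avgMatrix n * avgMatrix n = avgMatrix n := by
  have : (n : ℝ) ≠ 0 := by positivity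
  ext i j
  simp [Matrix.mul_apply, this]

lemma mul_avgMatrix {n : ℕ} {W : Matrix (Fin n) (Fin n) ℝ}
    (h : W *ᵥ (fun _ => 1) = fun _ => 1) : W * avgMatrix n = avgMatrix n := by
  ext i j
  have := congrFun h i
  simp only [mulVec, dotProduct, mul_one] at this
  simp [Matrix.mul_apply, ← Finset.sum_mul, this]

lemma avgMatrix_mul {n : ℕ} {W : Matrix (Fin n) (Fin n) ℝ}
    (h : Wᵀ *ᵥ (fun _ => 1) = fun _ => 1) : avgMatrix n * W = avgMatrix n := by
  have := congrArg Matrix.transpose (mul_avgMatrix h)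
  rw [Matrix.transpose_mul, Matrix.transpose_transpose] at this
  exact this

lemma sub_avgMatrix_pow {n : ℕ} (hn : 0 < n) {W : Matrix (Fin n) (Fin n) ℝ}
    (h1 : W *ᵥ (fun _ => 1) = fun _ => 1) (h2 : Wᵀ *ᵥ (fun _ => 1) = fun _ => 1)
    {k : ℕ} (hk : 1 ≤ k) :
    (W - avgMatrix n) ^ k = W ^ k - avgMatrix n ∧ W ^ k * avgMatrix n = avgMatrix n ∧
      avgMatrix n * W ^ k = avgMatrix n := by
  induction k, hk using Nat.le_induction with
  | base => simp [mul_avgMatrix h1, avgMatrix_mul h2]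
  | succ k hk ih =>
    obtain ⟨ih1, ih2, ih3⟩ := ih
    refine ⟨?_, ?_, ?_⟩
    · rw [pow_succ, ih1, sub_mul, mul_sub, mul_sub, ih2, avgMatrix_mul h2,
        avgMatrix_mul_self hn, pow_succ, sub_self, sub_zero]
    · rw [pow_succ, Matrix.mul_assoc, mul_avgMatrix h1, ih2]
    · rw [pow_succ, ← Matrix.mul_assoc, ih3, avgMatrix_mul h2]

/-- Mixing contracts the deviation from any consensus vector. -/
lemma stackNorm_mix_sub_mean_le {n d : ℕ} (hn : 0 < n) {W : Matrix (Fin n) (Fin n) ℝ}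
    (h1 : W *ᵥ (fun _ => 1) = fun _ => 1) (h2 : Wᵀ *ᵥ (fun _ => 1) = fun _ => 1)
    {k : ℕ} (hk : 1 ≤ k) {x y : Fin n → Fin d → ℝ}
    (hy : ∀ j, y j = ∑ i, (W ^ k) j i • x i) (c : Fin d → ℝ) :
    stackNorm (fun j => y j - (n : ℝ)⁻¹ • ∑ i, y i) ≤
      specNorm (W - avgMatrix n) ^ k * stackNorm (fun j => x j - c) := by
  obtain ⟨hpow, hr, hl⟩ := sub_avgMatrix_pow hn h1 h2 hk
  have hn' : (n : ℝ) ≠ 0 := by positivity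
  have hmean : (n : ℝ)⁻¹ • ∑ i, y i = ∑ i, (n : ℝ)⁻¹ • x i := by
    simp_rw [hy]
    rw [Finset.sum_comm, Finset.smul_sum]
    refine Finset.sum_congr rfl fun i _ => ?_
    have := congrFun (congrFun hl ⟨0, hn⟩) i
    simp only [Matrix.mul_apply, Matrix.of_apply, ← Finset.mul_sum] at this
    rw [← Finset.sum_smul, smul_smul, this]
  have hrow (j : Fin n) : ∑ i, ((W - avgMatrix n) ^ k) j i = 0 := by
    have := congrFun (congrFun hr j) j
    simp only [Matrix.mul_apply, Matrix.of_apply, ← Finset.sum_mul] at this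
    have hsum : ∑ i, (W ^ k) j i = 1 := by
      field_simp at this
      exact this
    rw [hpow]
    simp [hsum, hn']
  have hdev : (fun j => y j - (n : ℝ)⁻¹ • ∑ i, y i) =
      fun j => ∑ i, ((W - avgMatrix n) ^ k) j i • (x i - c) := by
    ext1 j
    simp_rw [smul_sub]
    rw [Finset.sum_sub_distrib, ← Finset.sum_smul, hrow, zero_smul, sub_zero, hmean, hy, hpow,
      ← Finset.sum_sub_distrib]
    exact Finset.sum_congr rfl fun i _ => by rw [← sub_smul]; rfl
  rw [hdev]
  exact (stackNorm_sum_smul_le _ _).trans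
    (mul_le_mul_of_nonneg_right (specNorm_pow_le _ hk) (stackNorm_nonneg _))

section Loewner

variable {d : ℕ} {A : Matrix (Fin d) (Fin d) ℝ} {σ L μ : ℝ}

lemma mul_dotProduct_le_of_posSemidef_sub
    (h : (A - σ • (1 : Matrix (Fin d) (Fin d) ℝ)).PosSemidef) (u : Fin d → ℝ) :
    σ * (u ⬝ᵥ u) ≤ u ⬝ᵥ A *ᵥ u := by
  have := h.dotProduct_mulVec_nonneg u
  simpa [Matrix.sub_mulVec, Matrix.smul_mulVec, dotProduct_sub] using this

lemma dotProduct_le_mul_of_posSemidef_sub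
    (h : (L • (1 : Matrix (Fin d) (Fin d) ℝ) - A).PosSemidef) (u : Fin d → ℝ) :
    u ⬝ᵥ A *ᵥ u ≤ L * (u ⬝ᵥ u) := by
  have := h.dotProduct_mulVec_nonneg u
  simpa [Matrix.sub_mulVec, Matrix.smul_mulVec, dotProduct_sub] using this

/-- Co-coercivity of `u ↦ A u` for `0 ⪯ A ⪯ L I`. -/
lemma mulVec_dotProduct_mulVec_le (hA : A.IsSymm) (hL : 0 < L)
    (h0 : ∀ u, 0 ≤ u ⬝ᵥ A *ᵥ u) (h1 : ∀ u, u ⬝ᵥ A *ᵥ u ≤ L * (u ⬝ᵥ u)) (u : Fin d → ℝ) :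
    A *ᵥ u ⬝ᵥ A *ᵥ u ≤ L * (u ⬝ᵥ A *ᵥ u) := by
  have hz := h0 (L • u - A *ᵥ u)
  have hAu := h1 (A *ᵥ u)
  have hsymm : u ⬝ᵥ A *ᵥ (A *ᵥ u) = A *ᵥ u ⬝ᵥ A *ᵥ u := by
    rw [dotProduct_mulVec, ← mulVec_transpose, hA.eq]
  simp only [mulVec_sub, mulVec_smul, sub_dotProduct, dotProduct_sub, smul_dotProduct,
    dotProduct_smul, smul_eq_mul, hsymm] at hz
  have : 0 ≤ L * (L * (u ⬝ᵥ A *ᵥ u) - A *ᵥ u ⬝ᵥ A *ᵥ u) := by linarith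
  linarith [nonneg_of_mul_nonneg_right this hL]

/-- `‖A‖ ≤ L` for `0 ⪯ A ⪯ L I`. -/
lemma vecNorm_mulVec_le_mul (hA : A.IsSymm) (hL : 0 < L)
    (h0 : ∀ u, 0 ≤ u ⬝ᵥ A *ᵥ u) (h1 : ∀ u, u ⬝ᵥ A *ᵥ u ≤ L * (u ⬝ᵥ u)) (u : Fin d → ℝ) :
    vecNorm (A *ᵥ u) ≤ L * vecNorm u := by
  have h := mulVec_dotProduct_mulVec_le hA hL h0 h1 u
  have hcs := mul_le_mul_of_nonneg_left (dotProduct_le_vecNorm_mul u (A *ᵥ u)) hL.le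
  rw [← vecNorm_sq] at h
  rcases (vecNorm_nonneg (A *ᵥ u)).eq_or_lt with h' | h'
  · rw [← h']
    exact mul_nonneg hL.le (vecNorm_nonneg u)
  · exact le_of_mul_le_mul_right (by linarith) h'

/-- `‖(A + μ I)⁻¹ A‖ ≤ L / (L + μ)` for `0 ⪯ A ⪯ L I`. -/
lemma vecNorm_le_of_add_smul_mulVec_eq (hA : A.IsSymm) (hL : 0 < L) (hμ : 0 ≤ μ)
    (h0 : ∀ u, 0 ≤ u ⬝ᵥ A *ᵥ u) (h1 : ∀ u, u ⬝ᵥ A *ᵥ u ≤ L * (u ⬝ᵥ u)) {v w : Fin d → ℝ}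
    (hinj : A *ᵥ (v - w) = 0 → v - w = 0) (hw : A *ᵥ w + μ • w = A *ᵥ v) :
    vecNorm w ≤ L / (L + μ) * vecNorm v := by
  have hu : A *ᵥ (v - w) = μ • w := by rw [mulVec_sub, ← hw]; abel
  rcases hμ.eq_or_lt with rfl | hμ
  · rw [sub_eq_zero.mp (hinj (by simpa using hu)), add_zero, div_self hL.ne', one_mul]
  have h := mulVec_dotProduct_mulVec_le hA hL h0 h1 (v - w)
  simp only [hu, smul_dotProduct, dotProduct_smul, smul_eq_mul, sub_dotProduct] at h
  have h' : (L + μ) * (w ⬝ᵥ w) ≤ L * (v ⬝ᵥ w) := by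
    refine le_of_mul_le_mul_left ?_ hμ
    linarith
  have hcs := mul_le_mul_of_nonneg_left (dotProduct_le_vecNorm_mul v w) hL.le
  rw [← vecNorm_sq] at h'
  rw [div_mul_eq_mul_div, le_div_iff₀ (by positivity)]
  rcases (vecNorm_nonneg w).eq_or_lt with hw0 | hw0
  · rw [← hw0, zero_mul]
    exact mul_nonneg hL.le (vecNorm_nonneg v)
  · exact le_of_mul_le_mul_right (by linarith) hw0

lemma isUnit_det_add_smul_one (hσμ : 0 < σ + μ)
    (h : (A - σ • (1 : Matrix (Fin d) (Fin d) ℝ)).PosSemidef) :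
    IsUnit (A + μ • (1 : Matrix (Fin d) (Fin d) ℝ)).det := by
  have hp : (A + μ • (1 : Matrix (Fin d) (Fin d) ℝ)).PosDef := by
    have := Matrix.PosDef.posSemidef_add h (Matrix.PosDef.one.smul hσμ)
    convert this using 1
    rw [add_smul]
    abel
  exact (Matrix.isUnit_iff_isUnit_det _).mp hp.isUnit

/-- `‖(A + μ I)⁻¹‖ ≤ 1 / (σ + μ)` for `σ I ⪯ A`. -/
lemma vecNorm_inv_mulVec_le (hσμ : 0 < σ + μ)
    (h : (A - σ • (1 : Matrix (Fin d) (Fin d) ℝ)).PosSemidef) (r : Fin d → ℝ) :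
    vecNorm ((A + μ • (1 : Matrix (Fin d) (Fin d) ℝ))⁻¹ *ᵥ r) ≤ 1 / (σ + μ) * vecNorm r := by
  set w := (A + μ • (1 : Matrix (Fin d) (Fin d) ℝ))⁻¹ *ᵥ r with hw
  have hr : A *ᵥ w + μ • w = r := by
    have : (A + μ • (1 : Matrix (Fin d) (Fin d) ℝ)) *ᵥ w = r := by
      rw [hw, mulVec_mulVec, Matrix.mul_nonsing_inv _ (isUnit_det_add_smul_one hσμ h), one_mulVec]
    simpa [Matrix.add_mulVec, Matrix.smul_mulVec] using this
  have hlow := mul_dotProduct_le_of_posSemidef_sub h w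
  have hcs := dotProduct_le_vecNorm_mul w r
  nth_rw 1 [← hr] at hcs
  rw [dotProduct_add, dotProduct_smul, smul_eq_mul, ← vecNorm_sq] at hcs
  rw [← vecNorm_sq] at hlow
  rw [div_mul_eq_mul_div, one_mul, le_div_iff₀ hσμ]
  rcases (vecNorm_nonneg w).eq_or_lt with hw0 | hw0
  · rw [← hw0, zero_mul]
    exact vecNorm_nonneg r
  · exact le_of_mul_le_mul_right (by nlinarith) hw0

end Loewner

/-- **Consensus-error recursion for Network-DANE with quadratic losses.**  For every
`t ≥ 1`,
`‖y⁽ᵗ⁾ − 1ₙ⊗ȳ⁽ᵗ⁾‖ ≤ (α + αL/(σ+μ))‖y⁽ᵗ⁻¹⁾ − 1ₙ⊗ȳ⁽ᵗ⁻¹⁾‖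
  + (α/(σ+μ))‖s⁽ᵗ⁻¹⁾ − ∇f(y⁽ᵗ⁻¹⁾)‖ + (αL/(L+μ))(β/(σ+μ))√n‖ȳ⁽ᵗ⁻¹⁾ − y*‖`. -/
theorem network_dane_quadratic_consensus_recursion
    (n d K : ℕ) (hn : 0 < n) (hd : 0 < d) (hK : 1 ≤ K)
    (σ L μ β α₀ α : ℝ)
    (hσ : 0 < σ) (hσL : σ ≤ L) (hμ0 : 0 ≤ μ)
    -- quadratic local losses with `σ I ⪯ H_j ⪯ L I`
    (H : Fin n → Matrix (Fin d) (Fin d) ℝ)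
    (b : Fin n → Fin d → ℝ)
    (hHsymm : ∀ j, (H j).IsSymm)
    (hHlow : ∀ j, (H j - σ • (1 : Matrix (Fin d) (Fin d) ℝ)).PosSemidef)
    (hHup : ∀ j, (L • (1 : Matrix (Fin d) (Fin d) ℝ) - H j).PosSemidef)
    -- global Hessian, gradient data and optimizer
    (Hbar : Matrix (Fin d) (Fin d) ℝ) (hHbar : Hbar = (n : ℝ)⁻¹ • ∑ j, H j)
    (bbar : Fin d → ℝ) (hbbar : bbar = (n : ℝ)⁻¹ • ∑ j, b j)
    (ystar : Fin d → ℝ) (hstar : Hbar.mulVec ystar + bbar = 0)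
    -- homogeneity parameter `β = max_j ‖H_j − H̄‖`
    (hβ : IsGreatest (Set.range fun j => specNorm (H j - Hbar)) β)
    -- mixing matrix and mixing rates
    (W : Matrix (Fin n) (Fin n) ℝ)
    (hW1 : W.mulVec (fun _ => 1) = fun _ => 1)
    (hW2 : Wᵀ.mulVec (fun _ => 1) = fun _ => 1)
    (hα₀ : α₀ = specNorm (W - Matrix.of fun _ _ => (n : ℝ)⁻¹))
    (hα₀lt : α₀ < 1) (hα : α = α₀ ^ K)
    -- the Network-DANE iterates
    (x y s : ℕ → Fin n → Fin d → ℝ)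
    (hinit_y : y 0 = x 0)
    (hinit_s : ∀ j, s 0 j = (H j).mulVec (y 0 j) + b j)
    (hy : ∀ t j, y (t + 1) j = ∑ i, (W ^ K) j i • x t i)
    (hs : ∀ t j, s (t + 1) j =
      (∑ i, (W ^ K) j i • s t i) + (H j).mulVec (y (t + 1) j - y t j))
    (hx : ∀ t j, x (t + 1) j =
      y (t + 1) j - ((H j + μ • 1)⁻¹).mulVec (s (t + 1) j)) :
    ∀ t : ℕ,
      stackNorm (fun j => y (t + 1) j - (n : ℝ)⁻¹ • ∑ i, y (t + 1) i)
        ≤ (α + α * L / (σ + μ)) * stackNorm (fun j => y t j - (n : ℝ)⁻¹ • ∑ i, y t i)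
          + α / (σ + μ) * stackNorm (fun j => s t j - (Hbar.mulVec (y t j) + bbar))
          + α * L / (L + μ) * (β / (σ + μ)) * (Real.sqrt n
              * vecNorm ((n : ℝ)⁻¹ • ∑ j, y t j - ystar)) := by
  subst hα hα₀
  have hL : 0 < L := hσ.trans_le hσL
  have hσμ : 0 < σ + μ := by linarith
  have hn' : (n : ℝ) ≠ 0 := by positivity
  have hβ0 : 0 ≤ β := by
    obtain ⟨j, hj⟩ := hβ.1
    exact hj ▸ norm_nonneg _
  have hα0 : 0 ≤ specNorm (W - avgMatrix n) ^ K := pow_nonneg (norm_nonneg _) K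
  intro t
  have hcontract := stackNorm_mix_sub_mean_le hn hW1 hW2 hK (hy t)
  change _ ≤ (specNorm (W - avgMatrix n) ^ K + specNorm (W - avgMatrix n) ^ K * L / (σ + μ)) * _
    + specNorm (W - avgMatrix n) ^ K / (σ + μ) * _
    + specNorm (W - avgMatrix n) ^ K * L / (L + μ) * (β / (σ + μ)) * _
  generalize specNorm (W - avgMatrix n) ^ K = α at hα0 hcontract ⊢
  set ybar := (n : ℝ)⁻¹ • ∑ i, y t i with hybar
  have hDy := stackNorm_nonneg (fun j => y t j - ybar)
  have hDs := stackNorm_nonneg (fun j => s t j - (Hbar.mulVec (y t j) + bbar))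
  have hDo := mul_nonneg (Real.sqrt_nonneg n) (vecNorm_nonneg (ybar - ystar))
  cases t with
  | zero =>
    have h := hcontract ybar
    rw [← hinit_y] at h
    refine h.trans ?_
    rw [add_mul, add_assoc, add_assoc]
    exact le_add_of_nonneg_right (by positivity)
  | succ t =>
    have hbar_symm : Hbar.IsSymm := by
      rw [hHbar]
      refine Matrix.IsSymm.smul ?_ _
      rw [Matrix.IsSymm, Matrix.transpose_sum]
      exact Finset.sum_congr rfl fun j _ => hHsymm j
    have hbar_low : (Hbar - σ • (1 : Matrix (Fin d) (Fin d) ℝ)).PosSemidef := by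
      have : Hbar - σ • (1 : Matrix (Fin d) (Fin d) ℝ) =
          (n : ℝ)⁻¹ • ∑ j, (H j - σ • (1 : Matrix (Fin d) (Fin d) ℝ)) := by
        rw [hHbar, Finset.sum_sub_distrib, smul_sub]
        simp [← Nat.cast_smul_eq_nsmul ℝ, smul_smul, hn']
      rw [this]
      exact (Matrix.posSemidef_sum _ fun j _ => hHlow j).smul (by positivity)
    have hbar_up : (L • (1 : Matrix (Fin d) (Fin d) ℝ) - Hbar).PosSemidef := by
      have : L • (1 : Matrix (Fin d) (Fin d) ℝ) - Hbar =
          (n : ℝ)⁻¹ • ∑ j, (L • (1 : Matrix (Fin d) (Fin d) ℝ) - H j) := by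
        rw [hHbar, Finset.sum_sub_distrib, smul_sub]
        simp [← Nat.cast_smul_eq_nsmul ℝ, smul_smul, hn']
      rw [this]
      exact (Matrix.posSemidef_sum _ fun j _ => hHup j).smul (by positivity)
    have hq0 (u : Fin d → ℝ) : 0 ≤ u ⬝ᵥ Hbar *ᵥ u :=
      (mul_nonneg hσ.le (vecNorm_sq u ▸ sq_nonneg _)).trans
        (mul_dotProduct_le_of_posSemidef_sub hbar_low u)
    have hq1 := dotProduct_le_mul_of_posSemidef_sub hbar_up
    have hinj (u : Fin d → ℝ) (hu : Hbar *ᵥ u = 0) : u = 0 := by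
      have := mul_dotProduct_le_of_posSemidef_sub hbar_low u
      rw [hu, dotProduct_zero] at this
      exact dotProduct_self_eq_zero.mp
        (le_antisymm (nonpos_of_mul_nonpos_right this hσ) (vecNorm_sq u ▸ sq_nonneg _))
    -- the consensus vector `w = (H̄ + μ I)⁻¹ H̄ (ȳ - y*)`
    obtain ⟨w, hw⟩ : ∃ w, Hbar *ᵥ w + μ • w = Hbar *ᵥ (ybar - ystar) := by
      refine ⟨(Hbar + μ • (1 : Matrix (Fin d) (Fin d) ℝ))⁻¹ *ᵥ (Hbar *ᵥ (ybar - ystar)), ?_⟩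
      have := Matrix.mul_nonsing_inv _ (isUnit_det_add_smul_one hσμ hbar_low)
      have := congrArg (fun M => M *ᵥ (Hbar *ᵥ (ybar - ystar))) this
      simp only [one_mulVec] at this
      rw [← mulVec_mulVec, Matrix.add_mulVec, Matrix.smul_mulVec, one_mulVec] at this
      exact this
    have hw_le := vecNorm_le_of_add_smul_mulVec_eq hbar_symm hL hμ0 hq0 hq1 (hinj _) hw
    have hsplit : (fun j => x (t + 1) j - (ybar - w)) = fun j =>
        (((y (t + 1) j - ybar)
          - (H j + μ • 1)⁻¹ *ᵥ (s (t + 1) j - (Hbar *ᵥ (y (t + 1) j) + bbar)))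
          - (H j + μ • 1)⁻¹ *ᵥ (Hbar *ᵥ (y (t + 1) j - ybar)))
          - (H j + μ • 1)⁻¹ *ᵥ ((Hbar - H j) *ᵥ w) := by
      ext1 j
      have hwj : w = (H j + μ • 1)⁻¹ *ᵥ (H j *ᵥ w + μ • w) := by
        have := Matrix.nonsing_inv_mul _ (isUnit_det_add_smul_one hσμ (hHlow j))
        have := congrArg (fun M => M *ᵥ w) this
        simp only [one_mulVec] at this
        rw [← mulVec_mulVec, Matrix.add_mulVec, Matrix.smul_mulVec, one_mulVec] at this
        exact this.symm
      have hsj : s (t + 1) j - (H j *ᵥ w + μ • w) =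
          (s (t + 1) j - (Hbar *ᵥ (y (t + 1) j) + bbar)) + Hbar *ᵥ (y (t + 1) j - ybar)
            + (Hbar - H j) *ᵥ w := by
        have hb : bbar = -(Hbar *ᵥ ystar) := eq_neg_of_add_eq_zero_right hstar
        rw [mulVec_sub] at hw
        rw [hb, mulVec_sub, Matrix.sub_mulVec, eq_sub_of_add_eq' hw]
        abel
      have hxj : x (t + 1) j - (ybar - w) =
          (y (t + 1) j - ybar) - (H j + μ • 1)⁻¹ *ᵥ (s (t + 1) j - (H j *ᵥ w + μ • w)) := by
        rw [hx, mulVec_sub, ← hwj]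
        abel
      rw [hxj, hsj, mulVec_add, mulVec_add]
      abel
    have hs_le : stackNorm (fun j =>
        (H j + μ • 1)⁻¹ *ᵥ (s (t + 1) j - (Hbar *ᵥ (y (t + 1) j) + bbar))) ≤
          1 / (σ + μ) * stackNorm (fun j => s (t + 1) j - (Hbar *ᵥ (y (t + 1) j) + bbar)) :=
      stackNorm_le_mul (by positivity) fun j => vecNorm_inv_mulVec_le hσμ (hHlow j) _
    have hy_le : stackNorm (fun j =>
        (H j + μ • 1)⁻¹ *ᵥ (Hbar *ᵥ (y (t + 1) j - ybar))) ≤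
          1 / (σ + μ) * L * stackNorm (fun j => y (t + 1) j - ybar) :=
      stackNorm_le_mul (by positivity) fun j => by
        rw [mul_assoc]
        exact (vecNorm_inv_mulVec_le hσμ (hHlow j) _).trans (mul_le_mul_of_nonneg_left
          (vecNorm_mulVec_le_mul hbar_symm hL hq0 hq1 _) (by positivity))
    have ho_le : stackNorm (fun j => (H j + μ • 1)⁻¹ *ᵥ ((Hbar - H j) *ᵥ w)) ≤
        1 / (σ + μ) * (β * (L / (L + μ))) * (√n * vecNorm (ybar - ystar)) := by
      rw [← stackNorm_const]
      refine stackNorm_le_mul (by positivity) fun j => ?_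
      refine (vecNorm_inv_mulVec_le hσμ (hHlow j) _).trans ?_
      rw [mul_assoc, mul_assoc]
      refine mul_le_mul_of_nonneg_left ?_ (by positivity)
      rw [← neg_sub (H j), neg_mulVec, vecNorm_neg]
      exact (vecNorm_mulVec_le _ _).trans
        (mul_le_mul (hβ.2 ⟨j, rfl⟩) hw_le (vecNorm_nonneg _) hβ0)
    have htri := (stackNorm_sub_le _ _).trans (add_le_add_left ((stackNorm_sub_le _ _).trans
      (add_le_add_left (stackNorm_sub_le (fun j => y (t + 1) j - ybar) fun j =>
          (H j + μ • 1)⁻¹ *ᵥ (s (t + 1) j - (Hbar *ᵥ (y (t + 1) j) + bbar)))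
        (stackNorm fun j => (H j + μ • 1)⁻¹ *ᵥ (Hbar *ᵥ (y (t + 1) j - ybar)))))
      (stackNorm fun j => (H j + μ • 1)⁻¹ *ᵥ ((Hbar - H j) *ᵥ w)))
    rw [← hsplit] at htri
    calc _ ≤ α * stackNorm (fun j => x (t + 1) j - (ybar - w)) := hcontract _
      _ ≤ α * (stackNorm (fun j => y (t + 1) j - ybar)
          + 1 / (σ + μ) * stackNorm (fun j => s (t + 1) j - (Hbar *ᵥ (y (t + 1) j) + bbar))
          + 1 / (σ + μ) * L * stackNorm (fun j => y (t + 1) j - ybar)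
          + 1 / (σ + μ) * (β * (L / (L + μ))) * (√n * vecNorm (ybar - ystar))) :=
        mul_le_mul_of_nonneg_left (by linarith) hα0
      _ = _ := by ring

end
end

section
/- Local mixing does not increase the sum of function values. Let f : ℝ^d → ℝ be differentiable, σ-strongly convex, and L-smooth, with κ = L/σ. Let W̃ ∈ ℝ^{n×n} satisfy W̃ 1_n = 1_n and W̃ᵀ1_n = 1_n, and let α = ‖W̃ − (1/n)1_n1_nᵀ‖ satisfy α ≤ 1/κ. For x ∈ ℝ^{nd} with blocks x_j ∈ ℝ^d, let y = (W̃ ⊗ I_d) x with blocks y_j. Then ∑_{j=1}^n f(y_j) ≤ ∑_{j=1}^n f(x_j). -/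
open Finset Matrix
open scoped RealInnerProductSpace

noncomputable section

/-- Applying `A ⊗ I` to a block vector scales its squared norm by at most `‖A‖²`. -/
theorem sum_norm_sq_sum_smul_le {m ι : Type*} [Fintype m] [DecidableEq m] [Fintype ι]
    (A : Matrix m m ℝ) (u : m → EuclideanSpace ℝ ι) :
    ∑ j, ‖∑ i, A j i • u i‖ ^ 2 ≤ specNorm A ^ 2 * ∑ i, ‖u i‖ ^ 2 := by
  have coord (k : ι) : ∑ j, (∑ i, A j i * u i k) ^ 2 ≤ specNorm A ^ 2 * ∑ i, u i k ^ 2 := by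
    have h := (Matrix.toEuclideanCLM (𝕜 := ℝ) A).le_opNorm (WithLp.toLp 2 fun i => u i k)
    have h2 := pow_le_pow_left₀ (norm_nonneg _) h 2
    rw [mul_pow, EuclideanSpace.real_norm_sq_eq, EuclideanSpace.real_norm_sq_eq] at h2
    simpa [specNorm, Matrix.mulVec, dotProduct] using h2
  calc ∑ j, ‖∑ i, A j i • u i‖ ^ 2 = ∑ k, ∑ j, (∑ i, A j i * u i k) ^ 2 := by
        rw [Finset.sum_comm]
        simp [EuclideanSpace.real_norm_sq_eq]
    _ ≤ ∑ k, specNorm A ^ 2 * ∑ i, u i k ^ 2 := Finset.sum_le_sum fun k _ => coord k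
    _ = specNorm A ^ 2 * ∑ i, ‖u i‖ ^ 2 := by
        rw [← Finset.mul_sum, Finset.sum_comm]
        simp [EuclideanSpace.real_norm_sq_eq]

/-- **Local mixing does not increase the sum of function values.**  For `f`
`σ`-strongly convex and `L`-smooth with `κ = L/σ`, a doubly stochastic mixing matrix
`W̃` with `α = ‖W̃ − (1/n)1ₙ1ₙᵀ‖ ≤ 1/κ`, and `y = (W̃ ⊗ I) x`, one has
`∑_j f(y_j) ≤ ∑_j f(x_j)`. -/
theorem mixing_does_not_increase_function_values
    {n d : ℕ} (hn : 0 < n) (σ L κ α : ℝ)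
    (hσ : 0 < σ) (hσL : σ ≤ L) (hκ : κ = L / σ)
    (f : EuclideanSpace ℝ (Fin d) → ℝ)
    (hdiff : Differentiable ℝ f)
    (hsc : ∀ a z, f a + ⟪gradient f a, z - a⟫ + σ / 2 * ‖z - a‖ ^ 2 ≤ f z)
    (hsm : ∀ a z, f z ≤ f a + ⟪gradient f a, z - a⟫ + L / 2 * ‖z - a‖ ^ 2)
    (Wt : Matrix (Fin n) (Fin n) ℝ)
    (hW1 : Wt.mulVec (fun _ => 1) = fun _ => 1)
    (hW2 : Wtᵀ.mulVec (fun _ => 1) = fun _ => 1)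
    (hα : α = specNorm (Wt - Matrix.of fun _ _ => (n : ℝ)⁻¹))
    (hακ : α ≤ 1 / κ)
    (x y : Fin n → EuclideanSpace ℝ (Fin d))
    (hy : ∀ j, y j = ∑ i, Wt j i • x i) :
    ∑ j, f (y j) ≤ ∑ j, f (x j) := by
  have hn' : (n : ℝ) ≠ 0 := by positivity
  have row (j : Fin n) : ∑ i, Wt j i = 1 := by
    simpa [Matrix.mulVec, dotProduct] using congrFun hW1 j
  have col (i : Fin n) : ∑ j, Wt j i = 1 := by
    simpa [Matrix.mulVec, dotProduct] using congrFun hW2 i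
  set m : EuclideanSpace ℝ (Fin d) := (n : ℝ)⁻¹ • ∑ i, x i with hm
  have x_dev : ∑ j, (x j - m) = 0 := by
    simp [Finset.sum_sub_distrib, hm, ← Nat.cast_smul_eq_nsmul ℝ, smul_smul, hn']
  have y_dev : ∑ j, (y j - m) = 0 := by
    rw [← x_dev, Finset.sum_sub_distrib, Finset.sum_sub_distrib]
    simp_rw [hy]
    rw [Finset.sum_comm]
    simp [← Finset.sum_smul, col]
  have y_eq (j : Fin n) : y j - m =
      ∑ i, (Wt - Matrix.of fun _ _ => (n : ℝ)⁻¹ : Matrix (Fin n) (Fin n) ℝ) j i • (x i - m) := by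
    simp only [Matrix.sub_apply, Matrix.of_apply, sub_smul, Finset.sum_sub_distrib]
    rw [← Finset.smul_sum, x_dev, smul_zero, sub_zero]
    simp_rw [smul_sub]
    rw [Finset.sum_sub_distrib, ← hy, ← Finset.sum_smul, row, one_smul]
  have contraction : ∑ j, ‖y j - m‖ ^ 2 ≤ α ^ 2 * ∑ j, ‖x j - m‖ ^ 2 := by
    simp_rw [y_eq, hα]
    exact sum_norm_sq_sum_smul_le _ _
  have hL : 0 < L := hσ.trans_le hσL
  have α_nonneg : 0 ≤ α := hα ▸ norm_nonneg _
  have hLα : L * α ≤ σ := by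
    rw [hκ, one_div_div, le_div_iff₀ hL] at hακ
    linarith
  have hLα2 : L * α ^ 2 ≤ σ := by
    have : α ≤ 1 := by nlinarith
    nlinarith
  have upper : ∑ j, f (y j) ≤ n * f m + L / 2 * ∑ j, ‖y j - m‖ ^ 2 := by
    refine (Finset.sum_le_sum fun j _ => hsm m (y j)).trans_eq ?_
    rw [Finset.sum_add_distrib, Finset.sum_add_distrib, ← inner_sum, y_dev, ← Finset.mul_sum]
    simp
  have lower : n * f m + σ / 2 * ∑ j, ‖x j - m‖ ^ 2 ≤ ∑ j, f (x j) := by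
    refine Eq.trans_le ?_ (Finset.sum_le_sum fun j _ => hsc m (x j))
    rw [Finset.sum_add_distrib, Finset.sum_add_distrib, ← inner_sum, x_dev, ← Finset.mul_sum]
    simp
  have dev_nonneg : 0 ≤ ∑ j, ‖x j - m‖ ^ 2 := by positivity
  nlinarith [mul_le_mul_of_nonneg_left contraction hL.le,
    mul_le_mul_of_nonneg_right hLα2 dev_nonneg]

end
end

section
/- Local mixing does not increase the sum of squared gradient norms for quadratic losses. Let f(x) = (1/2)xᵀH̄x + bᵀx + c with H̄ symmetric and σ I_d ⪯ H̄ ⪯ L I_d (0 < σ ≤ L), κ = L/σ. Let W̃ ∈ ℝ^{n×n} satisfy W̃ 1_n = 1_n and W̃ᵀ1_n = 1_n, and let α = ‖W̃ − (1/n)1_n1_nᵀ‖ satisfy ακ ≤ 1. For x ∈ ℝ^{nd} with blocks x_j ∈ ℝ^d, let y = (W̃ ⊗ I_d) x with blocks y_j. Then ∑_{j=1}^n ‖∇f(y_j)‖² ≤ ∑_{j=1}^n ‖∇f(x_j)‖². -/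
open Finset Matrix

noncomputable section

/-- The spectral norm bounds the action of a matrix on sums of squares. -/
theorem sum_mulVec_sq_le_specNorm {m : Type*} [Fintype m] [DecidableEq m]
    (A : Matrix m m ℝ) (w : m → ℝ) :
    ∑ i, (A *ᵥ w) i ^ 2 ≤ specNorm A ^ 2 * ∑ i, w i ^ 2 := by
  have h := (Matrix.toEuclideanCLM (𝕜 := ℝ) A).le_opNorm (WithLp.toLp 2 w)
  have h' := pow_le_pow_left₀ (norm_nonneg _) h 2
  rw [mul_pow, EuclideanSpace.real_norm_sq_eq, EuclideanSpace.real_norm_sq_eq] at h'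
  simpa [specNorm] using h'

/-- A matrix with unit row and column sums which is within spectral distance one of the
averaging matrix does not increase sums of squares. -/
theorem sum_mulVec_sq_le_of_specNorm_sub_average_le_one {n : ℕ} (hn : 0 < n)
    (W : Matrix (Fin n) (Fin n) ℝ)
    (hrow : ∀ i, ∑ j, W i j = 1) (hcol : ∀ j, ∑ i, W i j = 1)
    (hW : specNorm (W - Matrix.of fun _ _ => (n : ℝ)⁻¹) ≤ 1) (u : Fin n → ℝ) :
    ∑ i, (W *ᵥ u) i ^ 2 ≤ ∑ i, u i ^ 2 := by
  have hn' : (n : ℝ) ≠ 0 := by positivity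
  set m : ℝ := (n : ℝ)⁻¹ * ∑ i, u i with hm
  have hsum : ∑ i, u i = n * m := by rw [hm]; field_simp
  have hsumW : ∑ i, (W *ᵥ u) i = n * m := by
    simp only [Matrix.mulVec, dotProduct]
    rw [Finset.sum_comm]
    simp only [← Finset.sum_mul, hcol, one_mul, hsum]
  have hcentre : ∀ v : Fin n → ℝ, ∑ i, v i = n * m →
      ∑ i, (v i - m) ^ 2 = ∑ i, v i ^ 2 - n * m ^ 2 := by
    intro v hv
    have : ∀ i, (v i - m) ^ 2 = v i ^ 2 - 2 * m * v i + m ^ 2 := fun i => by ring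
    simp only [this, Finset.sum_add_distrib, Finset.sum_sub_distrib, ← Finset.mul_sum, hv,
      Finset.sum_const, Finset.card_univ, Fintype.card_fin, nsmul_eq_mul]
    ring
  have hdev : ∀ i, ((W - Matrix.of fun _ _ => (n : ℝ)⁻¹) *ᵥ fun j => u j - m) i
      = (W *ᵥ u) i - m := by
    intro i
    simp only [Matrix.mulVec, dotProduct, Matrix.sub_apply, Matrix.of_apply, sub_mul, mul_sub,
      Finset.sum_sub_distrib, ← Finset.sum_mul, ← Finset.mul_sum, hrow, hsum,
      Finset.sum_const, Finset.card_univ, Fintype.card_fin, nsmul_eq_mul]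
    field_simp
    ring
  have hle := sum_mulVec_sq_le_specNorm (W - Matrix.of fun _ _ => (n : ℝ)⁻¹) fun j => u j - m
  simp only [hdev] at hle
  have hle' := hle.trans <| mul_le_of_le_one_left (Finset.sum_nonneg fun i _ => sq_nonneg _)
    (pow_le_one₀ (norm_nonneg _) hW)
  rw [hcentre _ hsumW, hcentre _ hsum] at hle'
  linarith

/-- **Local mixing does not increase the sum of squared gradient norms for quadratic
losses.**  For the quadratic `f(x) = ½ xᵀH̄x + bᵀx + c` with `σ I ⪯ H̄ ⪯ L I`
(`∇f(x) = H̄x + b`), a doubly stochastic mixing matrix `W̃` with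
`α = ‖W̃ − (1/n)1ₙ1ₙᵀ‖` and `ακ ≤ 1`, and `y = (W̃ ⊗ I) x`, one has
`∑_j ‖∇f(y_j)‖² ≤ ∑_j ‖∇f(x_j)‖²`. -/
theorem mixing_does_not_increase_gradient_norms
    {n d : ℕ} (hn : 0 < n) (σ L κ α : ℝ)
    (hσ : 0 < σ) (hσL : σ ≤ L) (hκ : κ = L / σ)
    (Hbar : Matrix (Fin d) (Fin d) ℝ) (hsymm : Hbar.IsSymm)
    (hlow : (Hbar - σ • (1 : Matrix (Fin d) (Fin d) ℝ)).PosSemidef)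
    (hup : (L • (1 : Matrix (Fin d) (Fin d) ℝ) - Hbar).PosSemidef)
    (b : Fin d → ℝ) (c : ℝ)
    (Wt : Matrix (Fin n) (Fin n) ℝ)
    (hW1 : Wt.mulVec (fun _ => 1) = fun _ => 1)
    (hW2 : Wtᵀ.mulVec (fun _ => 1) = fun _ => 1)
    (hα : α = specNorm (Wt - Matrix.of fun _ _ => (n : ℝ)⁻¹))
    (hακ : α * κ ≤ 1)
    (x y : Fin n → Fin d → ℝ)
    (hy : ∀ j, y j = ∑ i, Wt j i • x i) :
    ∑ j, vecNorm (Hbar.mulVec (y j) + b) ^ 2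
      ≤ ∑ j, vecNorm (Hbar.mulVec (x j) + b) ^ 2 := by
  have hrow : ∀ i, ∑ j, Wt i j = 1 := fun i => by
    simpa [Matrix.mulVec, dotProduct] using congrFun hW1 i
  have hcol : ∀ j, ∑ i, Wt i j = 1 := fun j => by
    simpa [Matrix.mulVec, dotProduct] using congrFun hW2 j
  have hα0 : 0 ≤ α := hα ▸ norm_nonneg _
  have hκ1 : 1 ≤ κ := by rwa [hκ, one_le_div hσ]
  have hα1 : α ≤ 1 := (le_mul_of_one_le_right hα0 hκ1).trans hακ
  have hgrad : ∀ j k, (Hbar *ᵥ y j + b) k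
      = (Wt *ᵥ fun i => (Hbar *ᵥ x i + b) k) j := by
    intro j k
    rw [hy, Matrix.mulVec_sum]
    simp only [Matrix.mulVec_smul, Pi.add_apply, Finset.sum_apply, Pi.smul_apply, smul_eq_mul]
    simp only [Matrix.mulVec.eq_1 Wt, dotProduct, mul_add, Finset.sum_add_distrib,
      ← Finset.sum_mul, hrow, one_mul]
  have hsq : ∀ v : Fin d → ℝ, vecNorm v ^ 2 = ∑ k, v k ^ 2 := fun v =>
    Real.sq_sqrt (Finset.sum_nonneg fun i _ => sq_nonneg _)
  simp only [hsq]
  rw [Finset.sum_comm, Finset.sum_comm (γ := Fin n)]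
  refine Finset.sum_le_sum fun k _ => ?_
  simp only [hgrad]
  exact sum_mulVec_sq_le_of_specNorm_sub_average_le_one hn Wt hrow hcol (hα ▸ hα1) _

end
end
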